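/- For nonzero complex numbers a₁ and a₂, the conjugation identity A(-a₁) · A(-a₂) · A(-a₁)⁻¹ = A(-a₁²/a₂) holds. -/

import Mathlib

open Matrix Complex

noncomputable def A (a : ℂ) : Matrix (Fin 2) (Fin 2) ℂ :=
  (1/2 : ℂ) • !![(a + a⁻¹) * I, a - a⁻¹; a - a⁻¹, -((a + a⁻¹) * I)]

theorem A_mul_self {a : ℂ} (ha : a ≠ 0) : A a * A a = -1 := by
  have hI : I ^ 2 = -1 := I_sq
  ext i j
  fin_cases i <;> fin_cases j <;> simp [A, Matrix.mul_apply, Fin.sum_univ_two] <;>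
    field_simp <;> ring_nf <;> simp only [hI] <;> ring

theorem A_inv {a : ℂ} (ha : a ≠ 0) : (A a)⁻¹ = -A a :=
  Matrix.inv_eq_right_inv (by rw [mul_neg, A_mul_self ha, neg_neg])

theorem stmt_3 (a₁ a₂ : ℂ) (h₁ : a₁ ≠ 0) (h₂ : a₂ ≠ 0) :
    A (-a₁) * A (-a₂) * (A (-a₁))⁻¹ = A (-(a₁ ^ 2 / a₂)) := by
  have hI : I ^ 2 = -1 := I_sq
  rw [A_inv (neg_ne_zero.mpr h₁)]
  ext i j
  fin_cases i <;> fin_cases j <;> simp [A, Matrix.mul_apply, Fin.sum_univ_two] <;>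
    field_simp <;> ring_nf <;> simp only [hI] <;> ring
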